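/- Let p be an odd prime and r a positive integer. Then Σ_{k=1}^{(p^r−1)/2} G((p^r+1)/2, k) ≡ 0 (mod p^{r+4}), where G(n,k) = (n + 2k − 1) · (1/2)_n · (1/2 + k)_{n−1}^4 / ((n−1)!)^5 · (−1)^n · 2^{2n+1}. -/

import Mathlib

open Finset

/-- `a ≡ b (mod p^m)` for rationals: the `p`-adic valuation of `a - b` is at least `m`. -/
def pcong (p m : ℕ) (a b : ℚ) : Prop :=
  a = b ∨ (m : ℤ) ≤ padicValRat p (a - b)

/-- The rising factorial `(a)_n = a(a+1)⋯(a+n-1)`. -/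
noncomputable def rf (a : ℚ) (n : ℕ) : ℚ := (ascPochhammer ℚ n).eval a

/-- \`G(n,k) = (n + 2k − 1) · (1/2)_n · (1/2 + k)_{n−1}^4 / ((n−1)!)^5 · (−1)^n · 2^{2n+1}\`. -/
noncomputable def G (n k : ℕ) : ℚ :=
  ((n : ℚ) + 2 * k - 1) * rf (1/2) n * (rf (1/2 + k) (n - 1)) ^ 4 /
    ((n - 1).factorial : ℚ) ^ 5 * (-1) ^ n * 2 ^ (2 * n + 1)

/-- The `p`-adic valuation of `k * choose (n + k) k` is at most `log p (n + k)`. -/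
theorem padicValNat_choose_add_le_log {p n k : ℕ} (hp : p.Prime) (hk : k ≠ 0) :
    padicValNat p ((n + k).choose k) + padicValNat p k ≤ Nat.log p (n + k) := by
  rw [← Nat.factorization_def _ hp, ← Nat.factorization_def _ hp,
    Nat.factorization_choose' hp (Nat.lt_succ_self _)]
  have hv : k.factorization p ≤ Nat.log p (n + k) := by
    refine Nat.le_log_of_pow_le hp.one_lt ?_
    exact (Nat.ordProj_le p hk).trans (Nat.le_add_left k n)
  have hsub : {i ∈ Ico 1 (Nat.log p (n + k)).succ | p ^ i ≤ k % p ^ i + n % p ^ i} ⊆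
      Ico (k.factorization p + 1) (Nat.log p (n + k)).succ := by
    intro i hi
    simp only [mem_filter, mem_Ico] at hi ⊢
    refine ⟨?_, hi.1.2⟩
    by_contra! hlt
    have hdvd : p ^ i ∣ k := (hp.pow_dvd_iff_le_factorization hk).2 (by omega)
    have hlt' : n % p ^ i < p ^ i := Nat.mod_lt _ (pow_pos hp.pos i)
    rw [Nat.mod_eq_zero_of_dvd hdvd] at hi
    omega
  have hcard := card_le_card hsub
  rw [Nat.card_Ico] at hcard
  omega

theorem rf_pos {a : ℚ} (ha : 0 < a) (n : ℕ) : 0 < rf a n := ascPochhammer_pos n a ha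

theorem rf_succ (a : ℚ) (n : ℕ) : rf a (n + 1) = rf a n * (a + n) :=
  ascPochhammer_succ_eval n a

theorem rf_half_add_mul_factorial (k n : ℕ) :
    rf (1 / 2 + k) n * 4 ^ n * (2 * k).factorial * (n + k).factorial =
      (2 * n + 2 * k).factorial * k.factorial := by
  induction n with
  | zero => simp [rf]
  | succ n ih =>
    rw [rf_succ, show n + 1 + k = (n + k) + 1 by ring,
      show 2 * (n + 1) + 2 * k = (2 * n + 2 * k + 1) + 1 by ring]
    simp only [Nat.factorial_succ]
    push_cast
    linear_combination (2 * n + 2 * k + 1 + 1 : ℚ) * (2 * n + 2 * k + 1) * ih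

/-- For `2 * n + 1 = q`, clears denominators in `(1/2 + k)_n / n!` so that `q` appears. -/
theorem rf_half_add_div_factorial_mul (n k : ℕ) :
    rf (1 / 2 + ((k + 1 : ℕ) : ℚ)) n / n.factorial *
        (((n + (k + 1)).choose (k + 1) : ℕ) * ((k + 1 : ℕ) : ℚ) * (2 * 4 ^ n)) =
      ((2 * n + 1 : ℕ) : ℚ) *
        (((2 * n + 2 * (k + 1)).choose (2 * k + 1) * (2 * n).choose n : ℕ) : ℚ) := by
  have h := rf_half_add_mul_factorial (k + 1) n
  have h1 : (((n + (k + 1)).choose (k + 1) * n.factorial * (k + 1).factorial : ℕ) : ℚ) =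
      (n + (k + 1)).factorial := by
    exact_mod_cast Nat.add_choose_mul_factorial_mul_factorial _ _
  have h2 : (((2 * n + 2 * (k + 1)).choose (2 * (k + 1)) * (2 * n).factorial *
      (2 * (k + 1)).factorial : ℕ) : ℚ) = (2 * n + 2 * (k + 1)).factorial := by
    exact_mod_cast Nat.add_choose_mul_factorial_mul_factorial _ _
  have h3 : (((2 * n).choose n * n.factorial * n.factorial : ℕ) : ℚ) = (2 * n).factorial := by
    exact_mod_cast (by rw [two_mul]; exact Nat.add_choose_mul_factorial_mul_factorial _ _)
  have h4 : (((2 * n + 2 * (k + 1)).choose (2 * (k + 1)) * (2 * (k + 1)) : ℕ) : ℚ) =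
      ((2 * n + 2 * (k + 1)).choose (2 * k + 1) * (2 * n + 1) : ℕ) := by
    have := Nat.choose_succ_right_eq (2 * n + 2 * (k + 1)) (2 * k + 1)
    rw [show 2 * n + 2 * (k + 1) - (2 * k + 1) = 2 * n + 1 by omega] at this
    exact_mod_cast this
  have hn : (n.factorial : ℚ) ≠ 0 := by exact_mod_cast n.factorial_ne_zero
  have hk : ((k + 1).factorial : ℚ) ≠ 0 := by exact_mod_cast (k + 1).factorial_ne_zero
  have hk2 : ((2 * (k + 1)).factorial : ℚ) ≠ 0 := by
    exact_mod_cast (2 * (k + 1)).factorial_ne_zero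
  rw [← h1, ← h2, Nat.cast_mul, Nat.cast_mul, Nat.cast_mul, Nat.cast_mul, ← h3] at h
  push_cast at h h4 ⊢
  have h5 : rf (1 / 2 + ((k : ℚ) + 1)) n * 4 ^ n * ((n + (k + 1)).choose (k + 1) : ℚ) =
      ((2 * n + 2 * (k + 1)).choose (2 * (k + 1)) : ℚ) * (2 * n).choose n * n.factorial := by
    have hne := mul_ne_zero (mul_ne_zero hn hk) hk2
    apply mul_right_cancel₀ hne
    linear_combination h
  rw [div_mul_eq_mul_div, div_eq_iff hn]
  linear_combination (2 * (k + 1) : ℚ) * h5 + ((2 * n).choose n * n.factorial : ℚ) * h4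

theorem padicValRat_natCast_nonneg (p n : ℕ) : 0 ≤ padicValRat p (n : ℚ) := by
  rw [padicValRat.of_nat]
  exact Int.natCast_nonneg _

theorem padicValRat_two_pow {p : ℕ} [hp : Fact p.Prime] (hodd : Odd p) (n : ℕ) :
    padicValRat p (2 ^ n) = 0 := by
  have h : padicValNat p 2 = 0 := by
    refine padicValNat.eq_zero_of_not_dvd fun hdvd => ?_
    rw [(Nat.prime_dvd_prime_iff_eq hp.out Nat.prime_two).1 hdvd] at hodd
    exact absurd hodd (by decide)
  rw [padicValRat.pow, show (2 : ℚ) = ((2 : ℕ) : ℚ) by norm_num, padicValRat.of_nat, h]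
  simp

theorem one_le_padicValRat_rf_half_add_div_factorial {p r n k : ℕ} [hp : Fact p.Prime]
    (hodd : Odd p) (hn : 2 * n + 1 = p ^ r) (hk : k ∈ Icc 1 n) :
    1 ≤ padicValRat p (rf (1 / 2 + (k : ℚ)) n / n.factorial) := by
  rw [mem_Icc] at hk
  obtain ⟨k, rfl⟩ : ∃ j, k = j + 1 := ⟨k - 1, by omega⟩
  have h := congrArg (padicValRat p) (rf_half_add_div_factorial_mul n k)
  have hrf : rf (1 / 2 + ((k + 1 : ℕ) : ℚ)) n / n.factorial ≠ 0 :=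
    (div_pos (rf_pos (by positivity) n) (by positivity)).ne'
  have hc : (((n + (k + 1)).choose (k + 1) : ℕ) : ℚ) ≠ 0 := by
    exact_mod_cast (Nat.choose_pos (by omega)).ne'
  have hk1 : ((k + 1 : ℕ) : ℚ) ≠ 0 := by positivity
  have hb : (((2 * n + 2 * (k + 1)).choose (2 * k + 1) * (2 * n).choose n : ℕ) : ℚ) ≠ 0 := by
    exact_mod_cast (Nat.mul_pos (Nat.choose_pos (by omega)) (Nat.choose_pos (by omega))).ne'
  have h4 : (2 * 4 ^ n : ℚ) = 2 ^ (2 * n + 1) := by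
    rw [pow_succ, pow_mul]; norm_num [mul_comm]
  rw [h4, padicValRat.mul hrf (mul_ne_zero (mul_ne_zero hc hk1) (by positivity)),
    padicValRat.mul (mul_ne_zero hc hk1) (by positivity), padicValRat.mul hc hk1,
    padicValRat_two_pow hodd, padicValRat.mul (by positivity) hb, hn, padicValRat.of_nat,
    padicValRat.of_nat, padicValRat.of_nat, padicValNat.prime_pow] at h
  have hlog : Nat.log p (n + (k + 1)) < r := Nat.log_lt_of_lt_pow (by omega) (by omega)
  have hle := padicValNat_choose_add_le_log (n := n) hp.out k.succ_ne_zero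
  have hb' := padicValRat_natCast_nonneg p
    ((2 * n + 2 * (k + 1)).choose (2 * k + 1) * (2 * n).choose n)
  simp only [Nat.succ_eq_add_one] at hle
  omega

theorem le_padicValRat_rf_half_div_factorial {p r n : ℕ} [hp : Fact p.Prime]
    (hodd : Odd p) (hn : 2 * n + 1 = p ^ r) :
    (r : ℤ) ≤ padicValRat p (rf (1 / 2) (n + 1) / n.factorial) := by
  have hf : (n.factorial : ℚ) ≠ 0 := by exact_mod_cast n.factorial_ne_zero
  have h : rf (1 / 2) (n + 1) / n.factorial * 2 ^ (2 * n + 1) =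
      ((2 * n + 1 : ℕ) : ℚ) * ((2 * n).choose n : ℕ) := by
    have h0 := rf_half_add_mul_factorial 0 n
    have h3 : (((2 * n).choose n * n.factorial * n.factorial : ℕ) : ℚ) =
        (2 * n).factorial := by
      exact_mod_cast (by rw [two_mul]; exact Nat.add_choose_mul_factorial_mul_factorial _ _)
    simp only [mul_zero, add_zero, Nat.factorial_zero, Nat.cast_zero, Nat.cast_one, mul_one] at h0
    rw [← h3] at h0
    push_cast at h0 ⊢
    have h5 : rf (1 / 2) n * 4 ^ n = (2 * n).choose n * n.factorial :=
      mul_right_cancel₀ hf (by linear_combination h0)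
    rw [div_mul_eq_mul_div, div_eq_iff hf, rf_succ, pow_succ, pow_mul]
    norm_num only
    linear_combination (2 * n + 1 : ℚ) * h5
  have hrf : rf (1 / 2) (n + 1) / n.factorial ≠ 0 :=
    (div_pos (rf_pos (by positivity) _) (by positivity)).ne'
  have hc : (((2 * n).choose n : ℕ) : ℚ) ≠ 0 := by
    exact_mod_cast (Nat.choose_pos (by omega)).ne'
  have h' := congrArg (padicValRat p) h
  rw [padicValRat.mul hrf (by positivity), padicValRat_two_pow hodd,
    padicValRat.mul (by positivity) hc, hn, padicValRat.of_nat, padicValRat.of_nat,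
    padicValNat.prime_pow] at h'
  omega

/-- Every summand is already divisible by `p ^ (r + 4)`. -/
theorem le_padicValRat_G {p r n k : ℕ} [hp : Fact p.Prime]
    (hodd : Odd p) (hn : 2 * n + 1 = p ^ r) (hk : k ∈ Icc 1 n) :
    G (n + 1) k ≠ 0 ∧ ((r + 4 : ℕ) : ℤ) ≤ padicValRat p (G (n + 1) k) := by
  have hx := one_le_padicValRat_rf_half_add_div_factorial hodd hn hk
  have hy := le_padicValRat_rf_half_div_factorial hodd hn
  rw [mem_Icc] at hk
  have hfac : G (n + 1) k = ((n + 2 * k : ℕ) : ℚ) * (rf (1 / 2) (n + 1) / n.factorial) *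
      (rf (1 / 2 + (k : ℚ)) n / n.factorial) ^ 4 * (-1) ^ (n + 1) * 2 ^ (2 * (n + 1) + 1) := by
    have hf : (n.factorial : ℚ) ≠ 0 := by exact_mod_cast n.factorial_ne_zero
    simp only [G, Nat.add_sub_cancel]
    push_cast
    field_simp
    ring
  have hx0 : rf (1 / 2 + (k : ℚ)) n / n.factorial ≠ 0 :=
    (div_pos (rf_pos (by positivity) n) (by positivity)).ne'
  have hy0 : rf (1 / 2) (n + 1) / n.factorial ≠ 0 :=
    (div_pos (rf_pos (by positivity) _) (by positivity)).ne'
  have hk0 : ((n + 2 * k : ℕ) : ℚ) ≠ 0 := by exact_mod_cast (by omega : n + 2 * k ≠ 0)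
  have hs : ((-1 : ℚ)) ^ (n + 1) ≠ 0 := pow_ne_zero _ (by norm_num)
  have h12 := mul_ne_zero hk0 hy0
  have h123 := mul_ne_zero h12 (pow_ne_zero 4 hx0)
  have h1234 := mul_ne_zero h123 hs
  have hpow : (2 : ℚ) ^ (2 * (n + 1) + 1) ≠ 0 := by positivity
  refine ⟨hfac ▸ mul_ne_zero h1234 hpow, ?_⟩
  rw [hfac, padicValRat.mul h1234 hpow, padicValRat.mul h123 hs,
    padicValRat.mul h12 (pow_ne_zero 4 hx0), padicValRat.mul hk0 hy0, padicValRat_two_pow hodd,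
    padicValRat.pow, padicValRat.pow, padicValRat.neg, padicValRat.one]
  have := padicValRat_natCast_nonneg p (n + 2 * k)
  push_cast at this ⊢
  linarith

theorem padicNorm_le_zpow_neg_iff {p : ℕ} [hp : Fact p.Prime] {x : ℚ} (hx : x ≠ 0) (m : ℤ) :
    padicNorm p x ≤ (p : ℚ) ^ (-m) ↔ m ≤ padicValRat p x := by
  rw [padicNorm.eq_zpow_of_nonzero hx,
    zpow_le_zpow_iff_right₀ (by exact_mod_cast hp.out.one_lt), neg_le_neg_iff]

theorem stmt_7 (p : ℕ) (hp : p.Prime) (hodd : Odd p) (r : ℕ) (hr : 0 < r) :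
    pcong p (r + 4)
      (∑ k ∈ Icc 1 ((p ^ r - 1) / 2), G ((p ^ r + 1) / 2) k) 0 := by
  have : Fact p.Prime := ⟨hp⟩
  obtain ⟨n, hn⟩ := hodd.pow (n := r)
  rw [show (p ^ r - 1) / 2 = n by omega, show (p ^ r + 1) / 2 = n + 1 by omega]
  rw [pcong, sub_zero, or_iff_not_imp_left]
  intro hsum
  rw [← padicNorm_le_zpow_neg_iff hsum]
  refine padicNorm.sum_le' (fun k hk => ?_) (by positivity)
  obtain ⟨hG, hle⟩ := le_padicValRat_G hodd hn.symm hk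
  exact (padicNorm_le_zpow_neg_iff hG _).2 hle
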